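/- Let f be a strictly convex norm on ℝ^n. Then there exists δ₁ > 0, depending only on f, such that no set A ⊆ B_f^1 satisfying A ⊆ int B_f^{1+δ₁}(θ) for every θ ∈ A can be the set of asymptotic directions Γ_f(α) of the f-b.s.a. sequence for any α ∈ ℝ^n with α ∉ ℚ^n. -/

import Mathlib

open scoped BigOperators

/-- `f` is a (symmetric convex gauge) norm on `ℝ^n`. -/
structure IsGaugeNorm {n : ℕ} (f : (Fin n → ℝ) → ℝ) : Prop where
  continuous : Continuous f
  nonneg : ∀ x, 0 ≤ f x
  eq_zero_iff : ∀ x, f x = 0 ↔ x = 0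
  neg : ∀ x, f (-x) = f x
  smul : ∀ t : ℝ, 0 ≤ t → ∀ x, f (t • x) = t * f x
  add_le : ∀ x y, f (x + y) ≤ f x + f y

/-- The remainder vector `ξ = p·α − a`. -/
noncomputable def xiv {n : ℕ} (α : Fin n → ℝ) (p : ℤ) (a : Fin n → ℤ) : Fin n → ℝ :=
  fun j => (p : ℝ) * α j - (a j : ℝ)

/-- `(p, a)` with `p ≥ 1` is an `f`-best simultaneous approximation to `α`. -/
def IsFBSA {n : ℕ} (f : (Fin n → ℝ) → ℝ) (α : Fin n → ℝ) (p : ℤ) (a : Fin n → ℤ) : Prop :=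
  1 ≤ p ∧
  (∀ (q : ℤ) (b : Fin n → ℤ), 1 ≤ q → q ≤ p - 1 → f (xiv α p a) < f (xiv α q b)) ∧
  (∀ b : Fin n → ℤ, b ≠ a → f (xiv α p a) < f (xiv α p b))

/-- `τ : ℕ → ℤ × ℤ^n` is the (exhaustive) sequence of all `f`-b.s.a. to `α`,
with strictly increasing `p_ν`. -/
def IsFBSASeq {n : ℕ} (f : (Fin n → ℝ) → ℝ) (α : Fin n → ℝ)
    (τ : ℕ → ℤ × (Fin n → ℤ)) : Prop :=
  (∀ ν : ℕ, IsFBSA f α (τ ν).1 (τ ν).2) ∧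
  (∀ ν : ℕ, (τ ν).1 < (τ (ν + 1)).1) ∧
  (∀ (p : ℤ) (a : Fin n → ℤ), IsFBSA f α p a → ∃ ν : ℕ, τ ν = (p, a))

/-- The normalized remainder `Ξ_ν = ξ_ν / f(ξ_ν)`. -/
noncomputable def Xiv {n : ℕ} (f : (Fin n → ℝ) → ℝ) (α : Fin n → ℝ)
    (τ : ℕ → ℤ × (Fin n → ℤ)) (ν : ℕ) : Fin n → ℝ :=
  (f (xiv α (τ ν).1 (τ ν).2))⁻¹ • xiv α (τ ν).1 (τ ν).2

/-- `f` is strictly convex: the boundary of its unit ball contains no line segment. -/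
def StrictlyConvexNorm {n : ℕ} (f : (Fin n → ℝ) → ℝ) : Prop :=
  ∀ x y : Fin n → ℝ, f x = 1 → f y = 1 → x ≠ y →
    ∀ t : ℝ, t ∈ Set.Ioo (0 : ℝ) 1 → f (t • x + (1 - t) • y) < 1

/-- The set of limit points (along subsequences) of a sequence in `ℝ^n`. -/
def LimitPoints {n : ℕ} (u : ℕ → Fin n → ℝ) : Set (Fin n → ℝ) :=
  {x | ∃ φ : ℕ → ℕ, StrictMono φ ∧ Filter.Tendsto (u ∘ φ) Filter.atTop (nhds x)}

/-- `A ⊆ B_f^1` is `f`-asymptotically admissible: there is a sequence `θ_j` of points of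
`A` such that for each `j` the point `0 ∈ ∂B_f^1(θ_j)` is illuminated from `θ_{j+1}`, and
the set of limit points of `(θ_j)` is exactly `A`. -/
def AsympAdmissible {n : ℕ} (f : (Fin n → ℝ) → ℝ) (A : Set (Fin n → ℝ)) : Prop :=
  ∃ θ : ℕ → Fin n → ℝ, (∀ j : ℕ, θ j ∈ A) ∧
    (∀ j : ℕ, f (θ j) = 1 ∧ 1 < f (θ (j + 1) - θ j) ∧
      ∃ lam : ℝ, 0 < lam ∧ f (-(lam • θ (j + 1)) - θ j) < 1) ∧
    LimitPoints θ = A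

namespace IsGaugeNorm

variable {n : ℕ} {f : (Fin n → ℝ) → ℝ}

lemma sub_comm (hf : IsGaugeNorm f) (x y : Fin n → ℝ) : f (x - y) = f (y - x) := by
  rw [← hf.neg, neg_sub]

lemma exists_mul_norm_le (hf : IsGaugeNorm f) :
    ∃ c : ℝ, 0 < c ∧ ∀ x, c * ‖x‖ ≤ f x := by
  by_cases hne : (Metric.sphere (0 : Fin n → ℝ) 1).Nonempty
  · obtain ⟨z, hz, hmin⟩ :=
      (isCompact_sphere (0 : Fin n → ℝ) 1).exists_isMinOn hne hf.continuous.continuousOn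
    have hz1 : ‖z‖ = 1 := by simpa using hz
    have hz0 : z ≠ 0 := by
      rintro rfl
      simp at hz1
    refine ⟨f z, lt_of_le_of_ne (hf.nonneg z) fun h => hz0 ((hf.eq_zero_iff z).1 h.symm), ?_⟩
    intro x
    by_cases hx : x = 0
    · simpa [hx] using hf.nonneg 0
    have hx' : 0 < ‖x‖ := norm_pos_iff.2 hx
    have hmem : ‖x‖⁻¹ • x ∈ Metric.sphere (0 : Fin n → ℝ) 1 := by
      simp [norm_smul, hx'.ne']
    have h : f z ≤ f (‖x‖⁻¹ • x) := hmin hmem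
    rw [hf.smul _ (inv_nonneg.2 hx'.le), inv_mul_eq_div, le_div_iff₀ hx'] at h
    exact h
  · refine ⟨1, one_pos, fun x => ?_⟩
    by_cases hx : x = 0
    · simpa [hx] using hf.nonneg 0
    have hx' : 0 < ‖x‖ := norm_pos_iff.2 hx
    exact absurd ⟨‖x‖⁻¹ • x, by simp [norm_smul, hx'.ne']⟩ hne

lemma isCompact_unitBall (hf : IsGaugeNorm f) : IsCompact {x | f x ≤ 1} := by
  obtain ⟨c, hc, h⟩ := hf.exists_mul_norm_le
  refine (isCompact_closedBall (0 : Fin n → ℝ) c⁻¹).of_isClosed_subset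
    (isClosed_le hf.continuous continuous_const) fun x hx => ?_
  rw [mem_closedBall_zero_iff, ← one_div, le_div_iff₀ hc, mul_comm]
  exact (h x).trans hx

/-- Nonzero integer vectors are bounded away from zero. -/
lemma exists_pos_le_intCast (hf : IsGaugeNorm f) :
    ∃ c : ℝ, 0 < c ∧ ∀ b : Fin n → ℤ, b ≠ 0 → c ≤ f fun j => (b j : ℝ) := by
  obtain ⟨c, hc, h⟩ := hf.exists_mul_norm_le
  refine ⟨c, hc, fun b hb => ?_⟩
  obtain ⟨j, hj⟩ := Function.ne_iff.1 hb
  have h1 : (1 : ℝ) ≤ |(b j : ℝ)| := by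
    exact_mod_cast Int.one_le_abs hj
  have h2 : |(b j : ℝ)| ≤ ‖fun j => (b j : ℝ)‖ := norm_le_pi_norm (fun j => (b j : ℝ)) j
  nlinarith [h fun j => (b j : ℝ)]

/-- Among sufficiently many vectors of the unit ball, two are at distance less than `1 / 2`. -/
lemma exists_close_pair (hf : IsGaugeNorm f) :
    ∃ N : ℕ, ∀ u : ℕ → Fin n → ℝ, (∀ i, f (u i) ≤ 1) →
      ∃ i j, i < j ∧ j ≤ N ∧ f (u i - u j) < 1 / 2 := by
  obtain ⟨t, ht⟩ := hf.isCompact_unitBall.elim_finite_subcover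
    (fun z : Fin n → ℝ => {x | f (x - z) < 1 / 4})
    (fun z => isOpen_lt (hf.continuous.comp (continuous_id.sub continuous_const))
      continuous_const)
    (fun x _ => Set.mem_iUnion.2 ⟨x, by simp [(hf.eq_zero_iff 0).2 rfl]⟩)
  refine ⟨t.card + 1, fun u hu => ?_⟩
  have hcov : ∀ i, ∃ z ∈ t, f (u i - z) < 1 / 4 := fun i => by
    simpa using ht (hu i)
  choose g hgt hg using hcov
  obtain ⟨i, hi, j, hj, hij, hgij⟩ := Finset.exists_ne_map_eq_of_card_lt_of_maps_to
    (s := Finset.range (t.card + 1)) (t := t) (by simp) (f := g) (fun i _ => hgt i)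
  have hclose : f (u i - u j) < 1 / 2 := by
    have h := hf.add_le (u i - g i) (g i - u j)
    rw [sub_add_sub_cancel, hgij, hf.sub_comm (g j) (u j), ← hgij] at h
    have h2 := hg j
    rw [← hgij] at h2
    linarith [hg i]
  rw [Finset.mem_range] at hi hj
  rcases lt_or_gt_of_ne hij with h | h
  · exact ⟨i, j, h, hj.le, hclose⟩
  · exact ⟨j, i, h, hi.le, by rwa [hf.sub_comm]⟩

lemma sub_smul_le (hf : IsGaugeNorm f) (x y : Fin n → ℝ) {r : ℝ} (hr : 0 ≤ r) (hr' : r ≤ 1) :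
    f (x - r • y) ≤ (1 - r) * f x + r * f (x - y) := by
  have h := hf.add_le ((1 - r) • x) (r • (x - y))
  rw [hf.smul _ (by linarith), hf.smul _ hr] at h
  convert h using 2
  module

/-- Uniform form of strict convexity. -/
lemma exists_one_add_le_of_strictlyConvex (hf : IsGaugeNorm f) (hsc : StrictlyConvexNorm f)
    {s : ℝ} (hs0 : 0 < s) (hs1 : s < 1) :
    ∃ δ : ℝ, 0 < δ ∧ ∀ x y, f x = 1 → f y = 1 → 1 ≤ f (x - s • y) → 1 + δ ≤ f (x - y) := by
  have hfc := hf.continuous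
  set S : Set ((Fin n → ℝ) × (Fin n → ℝ)) :=
    {z | f z.1 = 1 ∧ f z.2 = 1 ∧ 1 ≤ f (z.1 - s • z.2)}
  have hSc : IsCompact S := by
    refine (hf.isCompact_unitBall.prod hf.isCompact_unitBall).of_isClosed_subset ?_
      fun z hz => ⟨hz.1.le, hz.2.1.le⟩
    exact (isClosed_eq (hfc.comp continuous_fst) continuous_const).inter
      ((isClosed_eq (hfc.comp continuous_snd) continuous_const).inter
        (isClosed_le continuous_const
          (hfc.comp (continuous_fst.sub (continuous_snd.const_smul s)))))
  by_cases hne : S.Nonempty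
  · obtain ⟨⟨x, y⟩, ⟨hx, hy, hxy⟩, hmin⟩ := hSc.exists_isMinOn hne
      (f := fun z => f (z.1 - z.2))
      (hfc.comp (continuous_fst.sub continuous_snd)).continuousOn
    refine ⟨f (x - y) - 1, ?_, fun x' y' hx' hy' h => ?_⟩
    · by_contra! hle
      dsimp only at hx hy hxy
      rcases (show f (x - y) ≤ 1 by linarith).lt_or_eq with hlt | heq
      · have := hf.sub_smul_le x y hs0.le hs1.le
        nlinarith
      · have hy0 : y ≠ 0 := by
          rintro rfl
          rw [(hf.eq_zero_iff 0).2 rfl] at hy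
          exact zero_ne_one hy
        have h := hsc x (x - y) hx heq (fun h => hy0 (sub_eq_self.1 h.symm)) (1 - s)
          ⟨by linarith, by linarith⟩
        rw [show (1 - s) • x + (1 - (1 - s)) • (x - y) = x - s • y by module] at h
        linarith
    · have h1 : f (x - y) ≤ f (x' - y') := hmin (show (x', y') ∈ S from ⟨hx', hy', h⟩)
      linarith
  · exact ⟨1, one_pos, fun x y hx hy h => absurd ⟨(x, y), hx, hy, h⟩ hne⟩

end IsGaugeNorm

lemma xiv_sub {n : ℕ} (α : Fin n → ℝ) (p q : ℤ) (a b : Fin n → ℤ) :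
    xiv α (p - q) (a - b) = xiv α p a - xiv α q b := by
  ext j
  simp only [xiv, Pi.sub_apply]
  push_cast
  ring

/-- Every sufficiently good approximation is dominated by a best approximation. -/
lemma exists_isFBSA_le {n : ℕ} {f : (Fin n → ℝ) → ℝ} (hf : IsGaugeNorm f) {c : ℝ}
    (hc : ∀ b : Fin n → ℤ, b ≠ 0 → c ≤ f fun j => (b j : ℝ)) (α : Fin n → ℝ) (N : ℕ) :
    ∀ (q : ℤ) (b : Fin n → ℤ), 1 ≤ q → q ≤ N → f (xiv α q b) < c / 2 →
      ∃ p a, IsFBSA f α p a ∧ p ≤ q ∧ f (xiv α p a) ≤ f (xiv α q b) := by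
  induction N with
  | zero =>
    intro q b h1 h2
    exact absurd (h1.trans h2) (by norm_num)
  | succ N ih =>
    intro q b h1 h2 h3
    by_cases hbest : ∀ (q' : ℤ) (b' : Fin n → ℤ), 1 ≤ q' → q' ≤ q - 1 →
        f (xiv α q b) < f (xiv α q' b')
    · refine ⟨q, b, ⟨h1, hbest, fun b' hb' => ?_⟩, le_rfl, le_rfl⟩
      by_contra! hle
      have h4 := hc (b - b') (sub_ne_zero.2 hb'.symm)
      have h5 := hf.add_le (xiv α q b') (-xiv α q b)
      rw [hf.neg, show xiv α q b' + -xiv α q b = fun j => (((b - b') j : ℤ) : ℝ) by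
        ext j
        simp [xiv]] at h5
      linarith
    · push Not at hbest
      obtain ⟨q', b', h1', h2', h3'⟩ := hbest
      obtain ⟨p, a, hpa, hp, hle⟩ := ih q' b' h1' (by push_cast at h2; omega) (by linarith)
      exact ⟨p, a, hpa, by omega, hle.trans h3'⟩

namespace IsFBSASeq

variable {n : ℕ} {f : (Fin n → ℝ) → ℝ} {α : Fin n → ℝ} {τ : ℕ → ℤ × (Fin n → ℤ)}

lemma strictMono_fst (hτ : IsFBSASeq f α τ) : StrictMono fun ν => (τ ν).1 :=
  strictMono_nat_of_lt_succ hτ.2.1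

lemma strictAnti_remainder (hτ : IsFBSASeq f α τ) :
    StrictAnti fun ν => f (xiv α (τ ν).1 (τ ν).2) :=
  strictAnti_nat_of_succ_lt fun ν =>
    (hτ.1 (ν + 1)).2.1 _ _ (hτ.1 ν).1 (by have := hτ.2.1 ν; omega)

lemma remainder_pos (hf : IsGaugeNorm f) (hτ : IsFBSASeq f α τ) (ν : ℕ) :
    0 < f (xiv α (τ ν).1 (τ ν).2) :=
  (hf.nonneg _).trans_lt (hτ.strictAnti_remainder ν.lt_succ_self)

lemma remainder_lt_sub (hτ : IsFBSASeq f α τ) {i j : ℕ} (hij : i < j) :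
    f (xiv α (τ j).1 (τ j).2) < f (xiv α (τ j).1 (τ j).2 - xiv α (τ i).1 (τ i).2) := by
  have h : (τ i).1 < (τ j).1 := hτ.strictMono_fst hij
  have h1 := (hτ.1 i).1
  rw [← xiv_sub]
  exact (hτ.1 j).2.1 _ _ (by omega) (by omega)

lemma apply_Xiv (hf : IsGaugeNorm f) (hτ : IsFBSASeq f α τ) (ν : ℕ) : f (Xiv f α τ ν) = 1 := by
  have h := hτ.remainder_pos hf ν
  rw [Xiv, hf.smul _ (inv_nonneg.2 h.le), inv_mul_cancel₀ h.ne']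

lemma smul_Xiv (hf : IsGaugeNorm f) (hτ : IsFBSASeq f α τ) (ν : ℕ) :
    f (xiv α (τ ν).1 (τ ν).2) • Xiv f α τ ν = xiv α (τ ν).1 (τ ν).2 := by
  rw [Xiv, smul_inv_smul₀ (hτ.remainder_pos hf ν).ne']

/-- The remainders halve over windows of bounded length. -/
lemma remainder_add_le_half (hf : IsGaugeNorm f) (hτ : IsFBSASeq f α τ) {N : ℕ}
    (hN : ∀ u : ℕ → Fin n → ℝ, (∀ i, f (u i) ≤ 1) →
      ∃ i j, i < j ∧ j ≤ N ∧ f (u i - u j) < 1 / 2) (ν : ℕ) :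
    f (xiv α (τ (ν + N)).1 (τ (ν + N)).2) ≤ f (xiv α (τ ν).1 (τ ν).2) / 2 := by
  have hpos := hτ.remainder_pos hf ν
  have hanti := hτ.strictAnti_remainder.antitone
  obtain ⟨i, j, hij, hj, h⟩ := hN
    (fun i => (f (xiv α (τ ν).1 (τ ν).2))⁻¹ • xiv α (τ (ν + i)).1 (τ (ν + i)).2) fun i => by
      rw [hf.smul _ (inv_nonneg.2 hpos.le), inv_mul_le_one₀ hpos]
      exact hanti (Nat.le_add_right ν i)
  rw [← smul_sub, hf.smul _ (inv_nonneg.2 hpos.le), inv_mul_eq_div, div_lt_iff₀ hpos,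
    hf.sub_comm] at h
  have h1 := hτ.remainder_lt_sub (show ν + i < ν + j by omega)
  have h2 : f (xiv α (τ (ν + N)).1 (τ (ν + N)).2) ≤ f (xiv α (τ (ν + j)).1 (τ (ν + j)).2) :=
    hanti (by omega)
  linarith

lemma eventually_remainder_lt (hf : IsGaugeNorm f) (hτ : IsFBSASeq f α τ) {ε : ℝ} (hε : 0 < ε) :
    ∃ m, ∀ ν, m ≤ ν → f (xiv α (τ ν).1 (τ ν).2) < ε := by
  obtain ⟨N, hN⟩ := hf.exists_close_pair
  have hgeom : ∀ k : ℕ, f (xiv α (τ (k * N)).1 (τ (k * N)).2) ≤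
      f (xiv α (τ 0).1 (τ 0).2) * (1 / 2) ^ k := by
    intro k
    induction k with
    | zero => simp
    | succ k ih =>
      have h := hτ.remainder_add_le_half hf hN (k * N)
      rw [show (k + 1) * N = k * N + N by ring, pow_succ]
      linarith
  have h0 := hτ.remainder_pos hf 0
  obtain ⟨k, hk⟩ := exists_pow_lt_of_lt_one (div_pos hε h0) (show (1 / 2 : ℝ) < 1 by norm_num)
  rw [lt_div_iff₀ h0] at hk
  refine ⟨k * N, fun ν hν => ?_⟩
  have h1 := hτ.strictAnti_remainder.antitone hν
  linarith [hgeom k]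

/-- Consecutive remainders drop by a definite factor infinitely often. -/
lemma exists_succ_remainder_le (hf : IsGaugeNorm f) (hτ : IsFBSASeq f α τ) {N : ℕ} {s : ℝ}
    (hs : 0 ≤ s) (hsN : 1 / 2 < s ^ N)
    (hN : ∀ u : ℕ → Fin n → ℝ, (∀ i, f (u i) ≤ 1) →
      ∃ i j, i < j ∧ j ≤ N ∧ f (u i - u j) < 1 / 2) (m : ℕ) :
    ∃ ν, m ≤ ν ∧
      f (xiv α (τ (ν + 1)).1 (τ (ν + 1)).2) ≤ s * f (xiv α (τ ν).1 (τ ν).2) := by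
  by_contra! hlt
  have hpow : ∀ k : ℕ, s ^ k * f (xiv α (τ m).1 (τ m).2) ≤
      f (xiv α (τ (m + k)).1 (τ (m + k)).2) := by
    intro k
    induction k with
    | zero => simp
    | succ k ih =>
      have h := hlt (m + k) (Nat.le_add_right m k)
      have h' := mul_le_mul_of_nonneg_left ih hs
      rw [← add_assoc, pow_succ']
      linarith
  have h1 := hτ.remainder_add_le_half hf hN m
  nlinarith [hpow N, hτ.remainder_pos hf m]

/-- No integer point before the next best approximation beats the current one. -/
lemma eventually_remainder_le_sub (hf : IsGaugeNorm f) (hτ : IsFBSASeq f α τ) :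
    ∃ m, ∀ ν, m ≤ ν → f (xiv α (τ ν).1 (τ ν).2) ≤
      f (xiv α (τ ν).1 (τ ν).2 - xiv α (τ (ν + 1)).1 (τ (ν + 1)).2) := by
  obtain ⟨c, hc, hint⟩ := hf.exists_pos_le_intCast
  obtain ⟨m, hm⟩ := hτ.eventually_remainder_lt hf (half_pos hc)
  refine ⟨m, fun ν hν => ?_⟩
  by_contra! hlt
  have hp := hτ.2.1 ν
  have hp1 := (hτ.1 ν).1
  rw [hf.sub_comm, ← xiv_sub] at hlt
  obtain ⟨p, a, hpa, hple, hfle⟩ := exists_isFBSA_le hf hint α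
    ((τ (ν + 1)).1 - (τ ν).1).toNat _ _ (by omega) (by omega) (hlt.trans (hm ν hν))
  obtain ⟨μ, hμ⟩ := hτ.2.2 p a hpa
  have hμν : μ < ν + 1 := hτ.strictMono_fst.lt_iff_lt.1 (by simp only [hμ]; omega)
  have h := hτ.strictAnti_remainder.antitone (Nat.lt_succ_iff.1 hμν)
  simp only [hμ] at h
  linarith

lemma one_le_Xiv_sub_smul (hf : IsGaugeNorm f) (hτ : IsFBSASeq f α τ) {s : ℝ} (hs : 0 < s)
    {ν : ℕ}
    (hdrop : f (xiv α (τ (ν + 1)).1 (τ (ν + 1)).2) ≤ s * f (xiv α (τ ν).1 (τ ν).2))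
    (hle : f (xiv α (τ ν).1 (τ ν).2) ≤
      f (xiv α (τ ν).1 (τ ν).2 - xiv α (τ (ν + 1)).1 (τ (ν + 1)).2)) :
    1 ≤ f (Xiv f α τ ν - s • Xiv f α τ (ν + 1)) := by
  have hX := hτ.apply_Xiv hf ν
  have e0 := hτ.smul_Xiv hf ν
  have e1 := hτ.smul_Xiv hf (ν + 1)
  have p0 := hτ.remainder_pos hf ν
  have p1 := hτ.remainder_pos hf (ν + 1)
  generalize Xiv f α τ ν = X at *
  generalize Xiv f α τ (ν + 1) = Y at *
  set F := f (xiv α (τ ν).1 (τ ν).2)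
  set G := f (xiv α (τ (ν + 1)).1 (τ (ν + 1)).2)
  rw [← e0, ← e1, show F • X - G • Y = F • (X - (G / (s * F)) • (s • Y)) by
    rw [smul_sub, smul_smul, smul_smul]
    congr 2
    field_simp, hf.smul _ p0.le] at hle
  have hr : 0 < G / (s * F) := by positivity
  have hr1 : G / (s * F) ≤ 1 := (div_le_one (by positivity)).2 hdrop
  have h := hf.sub_smul_le X (s • Y) hr.le hr1
  have h1 : 1 ≤ f (X - (G / (s * F)) • s • Y) := le_of_mul_le_mul_left (by simpa using hle) p0
  rw [hX] at h
  exact le_of_mul_le_mul_left (by linarith) hr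

end IsFBSASeq

/-- For a strictly convex norm `f` there is `δ₁ = δ₁(f) > 0` such that
no set `A ⊆ B_f^1` with `A ⊆ int B_f^{1+δ₁}(θ)` for every `θ ∈ A` can be the set of
asymptotic directions `Γ_f(α)` for any `α ∉ ℚ^n`. -/
theorem stmt19 (n : ℕ) (f : (Fin n → ℝ) → ℝ) (hf : IsGaugeNorm f)
    (hsc : StrictlyConvexNorm f) :
    ∃ δ₁ : ℝ, 0 < δ₁ ∧
      ∀ A : Set (Fin n → ℝ), A ⊆ {y : Fin n → ℝ | f y ≤ 1} →
        (∀ θ ∈ A, A ⊆ interior {y : Fin n → ℝ | f (y - θ) ≤ 1 + δ₁}) →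
        ∀ α : Fin n → ℝ, (¬ ∀ j : Fin n, ∃ q : ℚ, (q : ℝ) = α j) →
          ∀ τ : ℕ → ℤ × (Fin n → ℤ), IsFBSASeq f α τ →
            LimitPoints (Xiv f α τ) ≠ A := by
  obtain ⟨N, hN⟩ := hf.exists_close_pair
  obtain ⟨s, hs0, hs1, hsN⟩ : ∃ s : ℝ, 0 < s ∧ s < 1 ∧ 1 / 2 < s ^ N := by
    have hcont : Filter.Tendsto (fun s : ℝ => s ^ N) (nhdsWithin 1 (Set.Iio 1)) (nhds 1) := by
      simpa using ((continuous_pow N).tendsto (1 : ℝ)).mono_left nhdsWithin_le_nhds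
    obtain ⟨s, hs, hs0, hs1⟩ := ((hcont.eventually_const_lt (by norm_num : (1 / 2 : ℝ) < 1)).and
      (Ioo_mem_nhdsLT (zero_lt_one' ℝ))).exists
    exact ⟨s, hs0, hs1, hs⟩
  obtain ⟨δ, hδ, hsep⟩ := hf.exists_one_add_le_of_strictlyConvex hsc hs0 hs1
  refine ⟨δ / 2, half_pos hδ, ?_⟩
  rintro A - hA α - τ hτ rfl
  obtain ⟨m, hm⟩ := hτ.eventually_remainder_le_sub hf
  have hfreq : ∃ᶠ ν in Filter.atTop, 1 + δ ≤ f (Xiv f α τ ν - Xiv f α τ (ν + 1)) := by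
    rw [Filter.frequently_atTop]
    intro k
    obtain ⟨ν, hν, hdrop⟩ := hτ.exists_succ_remainder_le hf hs0.le hsN hN (max k m)
    exact ⟨ν, (le_max_left _ _).trans hν, hsep _ _ (hτ.apply_Xiv hf _) (hτ.apply_Xiv hf _)
      (hτ.one_le_Xiv_sub_smul hf hs0 hdrop (hm ν ((le_max_right _ _).trans hν)))⟩
  obtain ⟨φ, hφ, hφδ⟩ := Filter.extraction_of_frequently_atTop hfreq
  obtain ⟨⟨θ, θ'⟩, -, ψ, hψ, hlim⟩ :=
    (hf.isCompact_unitBall.prod hf.isCompact_unitBall).tendsto_subseq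
      (x := fun k => (Xiv f α τ (φ k), Xiv f α τ (φ k + 1)))
      fun k => ⟨(hτ.apply_Xiv hf _).le, (hτ.apply_Xiv hf _).le⟩
  have hθ : θ ∈ LimitPoints (Xiv f α τ) := ⟨φ ∘ ψ, hφ.comp hψ, hlim.fst_nhds⟩
  have hθ' : θ' ∈ LimitPoints (Xiv f α τ) :=
    ⟨fun k => φ (ψ k) + 1, fun _ _ h => Nat.succ_lt_succ ((hφ.comp hψ) h), hlim.snd_nhds⟩
  have hle : f (θ' - θ) ≤ 1 + δ / 2 :=
    interior_subset (s := {y | f (y - θ) ≤ 1 + δ / 2}) (hA θ hθ hθ')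
  have hge : 1 + δ ≤ f (θ - θ') :=
    ge_of_tendsto' ((hf.continuous.tendsto _).comp (hlim.fst_nhds.sub hlim.snd_nhds))
      fun k => hφδ (ψ k)
  rw [hf.sub_comm] at hle
  linarith
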